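/- Let P be a finite set of points in ℝ² in general position, let k ≥ 1, and let {u,v} be a pair of points of P that is a side of some triangle of the Delaunay triangulation of P. Then the number of pairs {p,q} of points of P that are useful order-k Delaunay edges and whose open segment pq intersects the open segment uv is at most (2k+1)². -/

import Mathlib

open EuclideanGeometry Set

noncomputable section

/-- Points of the Euclidean plane. -/
abbrev Pt : Type := EuclideanSpace ℝ (Fin 2)

noncomputable instance : DecidableEq Pt := Classical.decEq _

/-- `P` is in general position: no three (distinct) points collinear and
no four (distinct) points concyclic. -/
def GenPos (P : Set Pt) : Prop :=
  (∀ u v w : Pt, u ∈ P → v ∈ P → w ∈ P → u ≠ v → u ≠ w → v ≠ w →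
    ¬ Collinear ℝ ({u, v, w} : Set Pt)) ∧
  (∀ u v w z : Pt, u ∈ P → v ∈ P → w ∈ P → z ∈ P →
    u ≠ v → u ≠ w → u ≠ z → v ≠ w → v ≠ z → w ≠ z →
    ¬ EuclideanGeometry.Cospherical ({u, v, w, z} : Set Pt))

/-- The (closed) triangle spanned by a finite set of points. -/
def triSet (t : Finset Pt) : Set Pt := convexHull ℝ (t : Set Pt)

/-- `T` is a triangulation of `P`: a finite set of triangles with vertices in `P`,
every point of `P` is a vertex of some triangle, the interiors of the triangles are
pairwise disjoint, and their union is the convex hull of `P`. -/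
def IsTriangulation (P : Set Pt) (T : Set (Finset Pt)) : Prop :=
  T.Finite ∧
  (∀ t ∈ T, t.card = 3 ∧ (t : Set Pt) ⊆ P) ∧
  (∀ p ∈ P, ∃ t ∈ T, p ∈ t) ∧
  (T.Pairwise fun t s => interior (triSet t) ∩ interior (triSet s) = ∅) ∧
  (⋃ t ∈ T, triSet t) = convexHull ℝ P

/-- The triangle `t` (with vertex set `t`) is order-`k` Delaunay with respect to `P`:
the open disk bounded by its circumcircle contains at most `k` points of `P`. -/
def OrderKTri (P : Set Pt) (k : ℕ) (t : Finset Pt) : Prop :=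
  ∃ z : Pt, ∃ r : ℝ, (∀ p ∈ t, dist p z = r) ∧ {p ∈ P | dist p z < r}.encard ≤ (k : ℕ∞)

/-- `T` is an order-`k` Delaunay triangulation of `P`. -/
def IsOrderDT (P : Set Pt) (k : ℕ) (T : Set (Finset Pt)) : Prop :=
  IsTriangulation P T ∧ ∀ t ∈ T, OrderKTri P k t

/-- `{u, v}` is an order-`k` Delaunay edge of `P`: some open disk having `u` and `v`
on its boundary circle contains at most `k` points of `P`. -/
def OrderKEdge (P : Set Pt) (k : ℕ) (u v : Pt) : Prop :=
  ∃ z : Pt, ∃ r : ℝ, dist u z = r ∧ dist v z = r ∧ {p ∈ P | dist p z < r}.encard ≤ (k : ℕ∞)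

/-- `{u, v}` is a useful order-`k` Delaunay edge of `P`: some order-`k` Delaunay
triangulation of `P` contains a triangle having `u` and `v` among its vertices
(i.e. having segment `uv` as a side). -/
def UsefulEdge (P : Set Pt) (k : ℕ) (u v : Pt) : Prop :=
  ∃ T, IsOrderDT P k T ∧ ∃ t ∈ T, u ∈ t ∧ v ∈ t

/-- `{u, v}` is a Delaunay edge: it is an edge of the (unique) order-0 Delaunay
triangulation of `P`. -/
def DelaunayEdge (P : Set Pt) (u v : Pt) : Prop := UsefulEdge P 0 u v

/-- `p` lies strictly to the left of the directed line from `v` to `u`, i.e. the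
triple `v, u, p` makes a counterclockwise turn. -/
def ccw (v u p : Pt) : Prop :=
  0 < (u 0 - v 0) * (p 1 - v 1) - (u 1 - v 1) * (p 0 - v 0)


/-- Twice the signed area of the triangle `a b c`. -/
def orient (a b c : Pt) : ℝ := (b 0 - a 0) * (c 1 - a 1) - (b 1 - a 1) * (c 0 - a 0)

/-- The normalized equation of a circle: negative inside, zero on the circle. -/
def circ (A B C : ℝ) (x : Pt) : ℝ := x 0 ^ 2 + x 1 ^ 2 + A * x 0 + B * x 1 + C

lemma pt_ext {x y : Pt} (h0 : x 0 = y 0) (h1 : x 1 = y 1) : x = y := by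
  ext i
  fin_cases i
  · exact h0
  · exact h1

lemma orient_swap (a b c : Pt) : orient b a c = -orient a b c := by
  unfold orient; ring

lemma orient_rotate (a b c : Pt) : orient b c a = orient a b c := by
  unfold orient; ring

lemma orient_rotate_right (a b c : Pt) : orient c a b = orient a b c := by
  unfold orient; ring

lemma orient_self_left (a b : Pt) : orient a b a = 0 := by
  unfold orient; ring

lemma orient_self_right (a b : Pt) : orient a b b = 0 := by
  unfold orient; ring

lemma orient_comb (a b x y : Pt) {s t : ℝ} (h : s + t = 1) :
    orient a b (s • x + t • y) = s * orient a b x + t * orient a b y := by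
  obtain rfl : t = 1 - s := by linarith
  simp only [orient, PiLp.add_apply, PiLp.smul_apply, smul_eq_mul]
  ring

lemma circ_comb (A B C : ℝ) (x y z : Pt) {a b c : ℝ} (h : a + b + c = 1) :
    circ A B C (a • x + b • y + c • z) =
      a * circ A B C x + b * circ A B C y + c * circ A B C z
        - (a * b * ((x 0 - y 0) ^ 2 + (x 1 - y 1) ^ 2)
          + b * c * ((y 0 - z 0) ^ 2 + (y 1 - z 1) ^ 2)
          + a * c * ((x 0 - z 0) ^ 2 + (x 1 - z 1) ^ 2)) := by
  obtain rfl : c = 1 - a - b := by linarith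
  simp only [circ, PiLp.add_apply, PiLp.smul_apply, smul_eq_mul]
  ring

lemma circ_comb_le (A B C : ℝ) (x y z : Pt) {a b c : ℝ} (h : a + b + c = 1)
    (ha : 0 ≤ a) (hb : 0 ≤ b) (hc : 0 ≤ c) :
    circ A B C (a • x + b • y + c • z) ≤
      a * circ A B C x + b * circ A B C y + c * circ A B C z := by
  rw [circ_comb A B C x y z h]
  have : 0 ≤ a * b * ((x 0 - y 0) ^ 2 + (x 1 - y 1) ^ 2)
          + b * c * ((y 0 - z 0) ^ 2 + (y 1 - z 1) ^ 2)
          + a * c * ((x 0 - z 0) ^ 2 + (x 1 - z 1) ^ 2) := by positivity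
  linarith

lemma circ_comb_two_le (A B C : ℝ) (x y : Pt) {a b : ℝ} (h : a + b = 1)
    (ha : 0 ≤ a) (hb : 0 ≤ b) :
    circ A B C (a • x + b • y) ≤ a * circ A B C x + b * circ A B C y := by
  simpa using circ_comb_le A B C x y x (a := a) (b := b) (c := 0) (by linarith) ha hb le_rfl

lemma sq_dist_pos {x y : Pt} (h : x ≠ y) : 0 < (x 0 - y 0) ^ 2 + (x 1 - y 1) ^ 2 := by
  by_contra hc
  have h0 : (x 0 - y 0) ^ 2 = 0 := by nlinarith [sq_nonneg (x 0 - y 0), sq_nonneg (x 1 - y 1)]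
  have h1 : (x 1 - y 1) ^ 2 = 0 := by nlinarith [sq_nonneg (x 0 - y 0), sq_nonneg (x 1 - y 1)]
  exact h (pt_ext (by linarith [pow_eq_zero_iff (two_ne_zero) |>.1 h0])
    (by linarith [pow_eq_zero_iff (two_ne_zero) |>.1 h1]))

lemma circ_comb_two_lt (A B C : ℝ) {x y : Pt} (hxy : x ≠ y) {a b : ℝ} (h : a + b = 1)
    (ha : 0 < a) (hb : 0 < b) :
    circ A B C (a • x + b • y) < a * circ A B C x + b * circ A B C y := by
  have := circ_comb A B C x y x (a := a) (b := b) (c := 0) (by linarith)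
  have h2 := mul_pos (mul_pos ha hb) (sq_dist_pos hxy)
  simp only [zero_smul, add_zero, zero_mul, mul_zero] at this
  linarith

/-- The difference of two circle equations is affine. -/
lemma circ_sub_circ_comb (A B C A' B' C' : ℝ) (x y z : Pt) {a b c : ℝ} (h : a + b + c = 1) :
    circ A B C (a • x + b • y + c • z) - circ A' B' C' (a • x + b • y + c • z) =
      a * (circ A B C x - circ A' B' C' x) + b * (circ A B C y - circ A' B' C' y)
        + c * (circ A B C z - circ A' B' C' z) := by
  rw [circ_comb A B C x y z h, circ_comb A' B' C' x y z h]
  ring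

lemma circ_sub_circ_comb_two (A B C A' B' C' : ℝ) (x y : Pt) {a b : ℝ} (h : a + b = 1) :
    circ A B C (a • x + b • y) - circ A' B' C' (a • x + b • y) =
      a * (circ A B C x - circ A' B' C' x) + b * (circ A B C y - circ A' B' C' y) := by
  simpa using circ_sub_circ_comb A B C A' B' C' x y x (a := a) (b := b) (c := 0) (by linarith)

lemma collinear_of_orient_eq_zero {a b c : Pt} (h : orient a b c = 0) :
    Collinear ℝ ({a, b, c} : Set Pt) := by
  by_cases hab : a = b
  · subst hab
    simpa using collinear_pair ℝ a c
  · rw [collinear_iff_of_mem (p₀ := a) (by simp)]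
    refine ⟨b - a, ?_⟩
    have hd := sq_dist_pos hab
    have hn := hd.ne'
    unfold orient at h
    intro y hy
    simp only [Set.mem_insert_iff, Set.mem_singleton_iff] at hy
    rcases hy with rfl | rfl | rfl
    · exact ⟨0, by simp⟩
    · exact ⟨1, by simp⟩
    · refine ⟨((y 0 - a 0) * (b 0 - a 0) + (y 1 - a 1) * (b 1 - a 1)) /
        ((a 0 - b 0) ^ 2 + (a 1 - b 1) ^ 2), pt_ext ?_ ?_⟩ <;>
      · simp only [vadd_eq_add, PiLp.add_apply, PiLp.smul_apply, PiLp.sub_apply, smul_eq_mul]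
        field_simp
        first
          | linear_combination (-(b 1 - a 1)) * h
          | linear_combination (b 0 - a 0) * h

lemma GenPos.orient_ne_zero {P : Set Pt} (h : GenPos P) {a b c : Pt} (ha : a ∈ P) (hb : b ∈ P)
    (hc : c ∈ P) (hab : a ≠ b) (hac : a ≠ c) (hbc : b ≠ c) : orient a b c ≠ 0 :=
  fun h0 => h.1 a b c ha hb hc hab hac hbc (collinear_of_orient_eq_zero h0)

lemma GenPos.circ_ne_zero {P : Set Pt} (h : GenPos P) {a b c d : Pt} (ha : a ∈ P) (hb : b ∈ P)
    (hc : c ∈ P) (hd : d ∈ P) (hab : a ≠ b) (hac : a ≠ c) (had : a ≠ d) (hbc : b ≠ c)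
    (hbd : b ≠ d) (hcd : c ≠ d) {A B C : ℝ} (h1 : circ A B C a = 0) (h2 : circ A B C b = 0)
    (h3 : circ A B C c = 0) : circ A B C d ≠ 0 := by
  intro h4
  refine h.2 a b c d ha hb hc hd hab hac had hbc hbd hcd
    ⟨!₂[-A / 2, -B / 2], √(A ^ 2 / 4 + B ^ 2 / 4 - C), ?_⟩
  intro y hy
  have hy0 : circ A B C y = 0 := by
    simp only [Set.mem_insert_iff, Set.mem_singleton_iff] at hy
    rcases hy with rfl | rfl | rfl | rfl <;> assumption
  rw [EuclideanSpace.dist_eq]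
  congr 1
  simp only [Real.dist_eq, sq_abs, Fin.sum_univ_two, Matrix.cons_val_zero, Matrix.cons_val_one]
  unfold circ at hy0
  linear_combination hy0

lemma exists_circ_of_dist (z : Pt) {r : ℝ} (hr : 0 ≤ r) :
    ∃ A B C : ℝ, ∀ y : Pt,
      (dist y z = r ↔ circ A B C y = 0) ∧ (dist y z < r ↔ circ A B C y < 0) := by
  refine ⟨-2 * z 0, -2 * z 1, z 0 ^ 2 + z 1 ^ 2 - r ^ 2, fun y => ?_⟩
  have h : circ (-2 * z 0) (-2 * z 1) (z 0 ^ 2 + z 1 ^ 2 - r ^ 2) y = dist y z ^ 2 - r ^ 2 := by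
    rw [EuclideanSpace.dist_eq, Real.sq_sqrt (by positivity)]
    simp only [Real.dist_eq, sq_abs, Fin.sum_univ_two, circ]
    ring
  rw [h, sub_eq_zero, sub_neg, sq_eq_sq₀ dist_nonneg hr, sq_lt_sq₀ dist_nonneg hr]
  exact ⟨Iff.rfl, Iff.rfl⟩

lemma OrderKTri.exists_circ {P : Set Pt} {k : ℕ} {t : Finset Pt} (h : OrderKTri P k t)
    (ht : t.Nonempty) : ∃ A B C : ℝ, (∀ y ∈ t, circ A B C y = 0) ∧
      {y ∈ P | circ A B C y < 0}.encard ≤ k := by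
  obtain ⟨z, r, h1, h2⟩ := h
  obtain ⟨y, hy⟩ := ht
  obtain ⟨A, B, C, hc⟩ := exists_circ_of_dist z (r := r) (by rw [← h1 y hy]; exact dist_nonneg)
  refine ⟨A, B, C, fun y hy => (hc y).1.1 (h1 y hy), ?_⟩
  simpa only [(hc _).2] using h2

lemma DelaunayEdge.exists_circ {P : Set Pt} {u v : Pt} (h : DelaunayEdge P u v) :
    ∃ A B C : ℝ, circ A B C u = 0 ∧ circ A B C v = 0 ∧ ∀ y ∈ P, 0 ≤ circ A B C y := by
  obtain ⟨T, hT, t, ht, hu, hv⟩ := h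
  obtain ⟨A, B, C, h1, h2⟩ := (hT.2 t ht).exists_circ ⟨u, hu⟩
  refine ⟨A, B, C, h1 u hu, h1 v hv, fun y hy => ?_⟩
  by_contra hc
  have : {y ∈ P | circ A B C y < 0} = ∅ := by
    rw [← Set.encard_eq_zero]
    simpa using h2
  exact (this ▸ (⟨hy, not_le.1 hc⟩ : y ∈ {y ∈ P | circ A B C y < 0}) : y ∈ (∅ : Set Pt))

/-- The parameter of the circle through `p`, `q`, `y` in the pencil of circles through `p`, `q`. -/
def pencilParam (p q y : Pt) : ℝ :=
  -((y 0 - p 0) * (y 0 - q 0) + (y 1 - p 1) * (y 1 - q 1)) / orient p q y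

lemma exists_circ_pencil (p q y : Pt) : ∃ A B C : ℝ, circ A B C p = 0 ∧ circ A B C q = 0 ∧
    ∀ w, orient p q w ≠ 0 →
      circ A B C w = orient p q w * (pencilParam p q y - pencilParam p q w) := by
  set l := pencilParam p q y with hl
  refine ⟨-p 0 - q 0 - l * (q 1 - p 1), -p 1 - q 1 + l * (q 0 - p 0),
    p 0 * q 0 + p 1 * q 1 + l * ((q 1 - p 1) * p 0 - (q 0 - p 0) * p 1), ?_, ?_, fun w hw => ?_⟩
  · unfold circ; ring
  · unfold circ; ring
  · rw [mul_sub (orient p q w), pencilParam, mul_div_cancel₀ _ hw]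
    unfold circ orient; ring

lemma pos_left_of_circ_neg {A B C : ℝ} {c d : Pt} (hd : 0 ≤ circ A B C d)
    {s t : ℝ} (hst : s + t = 1) (hs : 0 ≤ s) (ht : 0 ≤ t) (hz : circ A B C (s • c + t • d) < 0)
    {a b : ℝ} (hab : a + b = 1) (hy : circ A B C (a • c + b • d) < 0) : 0 < a := by
  by_contra! ha
  have hs0 : 0 < s := by
    rcases hs.lt_or_eq with h | h
    · exact h
    · subst h
      obtain rfl : t = 1 := by linarith
      simp only [zero_smul, one_smul, zero_add] at hz
      linarith
  have hsa : 0 < s - a := by linarith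
  have key : d = (-a / (s - a)) • (s • c + t • d) + (s / (s - a)) • (a • c + b • d) := by
    obtain rfl : t = 1 - s := by linarith
    obtain rfl : b = 1 - a := by linarith
    apply pt_ext <;>
    · simp only [PiLp.add_apply, PiLp.smul_apply, smul_eq_mul]
      field_simp
      ring
  have h1 : 0 ≤ -a / (s - a) := div_nonneg (by linarith) hsa.le
  have h2 : 0 < s / (s - a) := div_pos hs0 hsa
  have h3 := circ_comb_two_le A B C (s • c + t • d) (a • c + b • d)
    (a := -a / (s - a)) (b := s / (s - a)) (by field_simp; ring) h1 h2.le
  rw [← key] at h3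
  nlinarith [mul_nonneg h1 (neg_nonneg.2 hz.le), mul_pos h2 (neg_pos.2 hy)]

lemma pos_of_circ_neg {A B C : ℝ} {c d : Pt} (hc : 0 ≤ circ A B C c) (hd : 0 ≤ circ A B C d)
    {s t : ℝ} (hst : s + t = 1) (hs : 0 ≤ s) (ht : 0 ≤ t) (hz : circ A B C (s • c + t • d) < 0)
    {a b : ℝ} (hab : a + b = 1) (hy : circ A B C (a • c + b • d) < 0) : 0 < a ∧ 0 < b := by
  refine ⟨pos_left_of_circ_neg hd hst hs ht hz hab hy, ?_⟩
  rw [add_comm] at hz hy hst hab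
  exact pos_left_of_circ_neg hc hst ht hs hz hab hy

/-- The barycentric coordinate of `y` at the vertex `a` of the triangle `a b c`. -/
def bary (a b c y : Pt) : ℝ := orient b c y / orient a b c

lemma bary_comb (a b c x y : Pt) {s t : ℝ} (h : s + t = 1) :
    bary a b c (s • x + t • y) = s * bary a b c x + t * bary a b c y := by
  unfold bary
  rw [orient_comb b c x y h]
  ring

lemma bary_sum {a b c : Pt} (h : orient a b c ≠ 0) (y : Pt) :
    bary a b c y + bary b c a y + bary c a b y = 1 := by
  unfold bary
  rw [orient_rotate_right a b c, orient_rotate a b c]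
  field_simp
  unfold orient
  ring

lemma bary_smul_add {a b c : Pt} (h : orient a b c ≠ 0) (y : Pt) :
    bary a b c y • a + bary b c a y • b + bary c a b y • c = y := by
  apply pt_ext <;>
  · simp only [PiLp.add_apply, PiLp.smul_apply, smul_eq_mul]
    unfold bary
    rw [orient_rotate_right a b c, orient_rotate a b c]
    field_simp
    unfold orient
    ring

lemma bary_self {a b c : Pt} (h : orient a b c ≠ 0) : bary a b c a = 1 := by
  unfold bary
  rw [orient_rotate, div_self h]

lemma bary_left (a b c : Pt) : bary a b c b = 0 := by
  unfold bary
  rw [orient_self_left, zero_div]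

lemma bary_right (a b c : Pt) : bary a b c c = 0 := by
  unfold bary
  rw [orient_self_right, zero_div]

lemma continuous_bary (a b c : Pt) : Continuous (bary a b c) := by
  unfold bary orient
  fun_prop

lemma mem_interior_triSet {a b c y : Pt} (h : orient a b c ≠ 0) (ha : 0 < bary a b c y)
    (hb : 0 < bary b c a y) (hc : 0 < bary c a b y) :
    y ∈ interior (triSet ({a, b, c} : Finset Pt)) := by
  rw [mem_interior]
  refine ⟨{z | 0 < bary a b c z} ∩ ({z | 0 < bary b c a z} ∩ {z | 0 < bary c a b z}), ?_, ?_,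
    ha, hb, hc⟩
  · rintro z ⟨h1, h2, h3⟩
    simp only [Set.mem_ofPred_eq] at h1 h2 h3
    rw [← bary_smul_add h z]
    have hconv : Convex ℝ (triSet ({a, b, c} : Finset Pt)) := convex_convexHull ℝ _
    have hmem : ∀ w ∈ ({a, b, c} : Finset Pt), w ∈ triSet ({a, b, c} : Finset Pt) :=
      fun w hw => subset_convexHull ℝ _ hw
    have := hconv.sum_mem (t := Finset.univ) (w := ![bary a b c z, bary b c a z, bary c a b z])
      (z := ![a, b, c]) (by simp [Fin.forall_fin_succ, h1.le, h2.le, h3.le])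
      (by simp [Fin.sum_univ_three, bary_sum h z])
      (by simp [Fin.forall_fin_succ, hmem])
    simpa [Fin.sum_univ_three] using this
  · exact (isOpen_lt continuous_const (continuous_bary a b c)).inter
      ((isOpen_lt continuous_const (continuous_bary b c a)).inter
        (isOpen_lt continuous_const (continuous_bary c a b)))

lemma bary_nonneg {a b c y : Pt} (h : orient a b c ≠ 0)
    (hy : y ∈ triSet ({a, b, c} : Finset Pt)) : 0 ≤ bary a b c y := by
  have hsub : triSet ({a, b, c} : Finset Pt) ⊆ {z | 0 ≤ bary a b c z} := by
    refine convexHull_min ?_ ?_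
    · intro z hz
      simp only [Finset.coe_insert, Finset.coe_singleton, Set.mem_insert_iff,
        Set.mem_singleton_iff] at hz
      rcases hz with rfl | rfl | rfl
      · simp [bary_self h]
      · simp [bary_left]
      · simp [bary_right]
    · intro x hx z hz s t hs ht hst
      simp only [Set.mem_ofPred_eq] at hx hz ⊢
      rw [bary_comb a b c x z hst]
      positivity
  exact hsub hy

lemma finset_rotate (a b c : Pt) : ({b, c, a} : Finset Pt) = {a, b, c} := by
  ext; simp; tauto

lemma bary_nonneg_all {a b c y : Pt} (h : orient a b c ≠ 0)
    (hy : y ∈ triSet ({a, b, c} : Finset Pt)) :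
    0 ≤ bary a b c y ∧ 0 ≤ bary b c a y ∧ 0 ≤ bary c a b y := by
  refine ⟨bary_nonneg h hy, bary_nonneg ?_ ?_, bary_nonneg ?_ ?_⟩
  · rwa [orient_rotate]
  · rwa [finset_rotate]
  · rwa [orient_rotate_right]
  · rwa [finset_rotate, finset_rotate]

section Triangulation

variable {P : Set Pt} {T : Set (Finset Pt)}

lemma IsTriangulation.exists_eq_triple (hT : IsTriangulation P T) (hgp : GenPos P)
    {t : Finset Pt} (ht : t ∈ T) {b : Pt} (hb : b ∈ t) :
    ∃ c d : Pt, t = {b, c, d} ∧ c ∈ P ∧ d ∈ P ∧ b ≠ c ∧ b ≠ d ∧ c ≠ d ∧ orient b c d ≠ 0 := by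
  obtain ⟨h3, hP⟩ := hT.2.1 t ht
  have h2 : (t.erase b).card = 2 := by rw [Finset.card_erase_of_mem hb, h3]
  obtain ⟨c, d, hcd, he⟩ := Finset.card_eq_two.1 h2
  have hc : c ∈ t.erase b := by simp [he]
  have hd : d ∈ t.erase b := by simp [he]
  rw [Finset.mem_erase] at hc hd
  exact ⟨c, d, by rw [← he, Finset.insert_erase hb], hP hc.2, hP hd.2, hc.1.symm, hd.1.symm, hcd,
    hgp.orient_ne_zero (hP hb) (hP hc.2) (hP hd.2) hc.1.symm hd.1.symm hcd⟩

lemma IsTriangulation.eq_of_mem_interior (hT : IsTriangulation P T) (hgp : GenPos P)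
    {t s : Finset Pt} (ht : t ∈ T) (hs : s ∈ T) {y : Pt} (hyt : y ∈ interior (triSet t))
    (hys : y ∈ triSet s) : t = s := by
  by_contra hne
  have hne' : s.Nonempty := Finset.card_pos.1 (by rw [(hT.2.1 s hs).1]; norm_num)
  obtain ⟨b, hb⟩ := hne'
  obtain ⟨c, d, rfl, -, -, -, -, -, ho⟩ := hT.exists_eq_triple hgp hs hb
  have hint : (interior (triSet ({b, c, d} : Finset Pt))).Nonempty := by
    have hthird : ∀ {a b c : Pt}, orient a b c ≠ 0 →
        bary a b c ((1 / 3 : ℝ) • a + (1 / 3 : ℝ) • b + (1 / 3 : ℝ) • c) = 1 / 3 := by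
      intro a b c h
      unfold bary
      field_simp
      simp only [orient, PiLp.add_apply, PiLp.smul_apply, smul_eq_mul]
      ring
    refine ⟨(1 / 3 : ℝ) • b + (1 / 3 : ℝ) • c + (1 / 3 : ℝ) • d, mem_interior_triSet ho ?_ ?_ ?_⟩
    · rw [hthird ho]; norm_num
    · rw [add_assoc, add_comm, hthird (by rwa [orient_rotate])]; norm_num
    · rw [add_comm, ← add_assoc, hthird (by rwa [orient_rotate_right])]
      norm_num
  have hcl := (convex_convexHull ℝ (({b, c, d} : Finset Pt) : Set Pt)).closure_interior_eq_closure_of_nonempty_interior hint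
  have hy : y ∈ closure (interior (triSet ({b, c, d} : Finset Pt))) := by
    unfold triSet
    rw [hcl]
    exact subset_closure hys
  obtain ⟨w, hw⟩ := mem_closure_iff.1 hy _ isOpen_interior hyt
  have := hT.2.2.2.1 ht hs hne
  exact (this ▸ hw : w ∈ (∅ : Set Pt))

lemma IsTriangulation.mem_of_mem_triSet (hT : IsTriangulation P T) (hgp : GenPos P)
    {t : Finset Pt} (ht : t ∈ T) {b : Pt} (hb : b ∈ P) (hbt : b ∈ triSet t) : b ∈ t := by
  by_contra hn
  obtain ⟨t', ht', hbt'⟩ := hT.2.2.1 b hb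
  have hne' : t.Nonempty := Finset.card_pos.1 (by rw [(hT.2.1 t ht).1]; norm_num)
  obtain ⟨a, ha⟩ := hne'
  have haP := (hT.2.1 t ht).2 ha
  obtain ⟨c, d, rfl, hc, hd, hac, had, hcd, ho⟩ := hT.exists_eq_triple hgp ht ha
  simp only [Finset.mem_insert, Finset.mem_singleton, not_or] at hn
  obtain ⟨h1, h2, h3⟩ := hn
  obtain ⟨n1, n2, n3⟩ := bary_nonneg_all ho hbt
  have hint : b ∈ interior (triSet ({a, c, d} : Finset Pt)) := by
    have hpos : ∀ {x y z : Pt}, orient x y z ≠ 0 → orient y z b ≠ 0 → 0 ≤ bary x y z b →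
        0 < bary x y z b := fun h h' h'' => lt_of_le_of_ne h'' (div_ne_zero h' h).symm
    refine mem_interior_triSet ho (hpos ho ?_ n1) (hpos ?_ ?_ n2) (hpos ?_ ?_ n3)
    · exact hgp.orient_ne_zero hc hd hb hcd (Ne.symm h2) (Ne.symm h3)
    · rwa [orient_rotate]
    · exact hgp.orient_ne_zero hd haP hb had.symm (Ne.symm h3) (Ne.symm h1)
    · rwa [orient_rotate_right]
    · exact hgp.orient_ne_zero haP hc hb hac (Ne.symm h1) (Ne.symm h2)
  have := hT.eq_of_mem_interior hgp ht ht' hint (subset_convexHull ℝ _ hbt')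
  rw [← this] at hbt'
  simp only [Finset.mem_insert, Finset.mem_singleton] at hbt'
  tauto

lemma eventually_comb_pos {m k : ℝ} (hm : 0 ≤ m) (h : 0 < m ∨ 0 < k) :
    ∀ᶠ e in nhdsWithin (0 : ℝ) (Set.Ioi 0), 0 < (1 - e) * m + e * k := by
  rcases hm.lt_or_eq with hm | rfl
  · have hc : Continuous fun e : ℝ => (1 - e) * m + e * k := by fun_prop
    exact (hc.tendsto 0).eventually (lt_mem_nhds (by simpa using hm)) |>.filter_mono
      nhdsWithin_le_nhds
  · filter_upwards [self_mem_nhdsWithin] with e he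
    have : 0 < k := by simpa using h
    simpa using mul_pos he this

lemma IsTriangulation.not_crossing (hT : IsTriangulation P T) (hgp : GenPos P) {b c d : Pt}
    (ht : ({b, c, d} : Finset Pt) ∈ T) (ho : orient b c d ≠ 0) {s : Finset Pt} (hs : s ∈ T)
    {p q : Pt} (hp : p ∈ s) (hq : q ∈ s) (hb : orient p q b ≠ 0) {x y : Pt}
    (hx : x ∈ segment ℝ p q) (hy : y ∈ segment ℝ p q)
    (hxb : 0 ≤ bary b c d x) (hxc : 0 ≤ bary c d b x) (hxd : 0 ≤ bary d b c x)
    (hb' : 0 < bary b c d x ∨ 0 < bary b c d y) (hc' : 0 < bary c d b x ∨ 0 < bary c d b y)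
    (hd' : 0 < bary d b c x ∨ 0 < bary d b c y) : False := by
  obtain ⟨e, ⟨⟨⟨h1, h2⟩, h3⟩, h4⟩, h5⟩ := ((((eventually_comb_pos hxb hb').and
    (eventually_comb_pos hxc hc')).and (eventually_comb_pos hxd hd')).and
    (Filter.Eventually.filter_mono nhdsWithin_le_nhds (gt_mem_nhds (zero_lt_one' ℝ)))).and
    (self_mem_nhdsWithin (s := Set.Ioi (0 : ℝ))) |>.exists
  have hsum : 1 - e + e = 1 := by ring
  rw [← bary_comb _ _ _ _ _ hsum] at h1 h2 h3
  have hz : (1 - e) • x + e • y ∈ segment ℝ p q :=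
    convex_segment p q hx hy (by linarith) (le_of_lt h5) hsum
  set z := (1 - e) • x + e • y
  have hzs : z ∈ triSet s :=
    (convex_convexHull ℝ _).segment_subset (subset_convexHull ℝ _ hp) (subset_convexHull ℝ _ hq) hz
  have := hT.eq_of_mem_interior hgp ht hs (mem_interior_triSet ho h1 h2 h3) hzs
  subst this
  obtain ⟨i, j, hi, hj, hij, hzz⟩ := hz
  have hcdz : bary b c d z = i * bary b c d p + j * bary b c d q := by
    rw [← hzz, bary_comb _ _ _ _ _ hij]
  simp only [Finset.mem_insert, Finset.mem_singleton] at hp hq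
  rcases hp with rfl | hp
  · exact hb (orient_self_left _ _)
  rcases hq with rfl | hq
  · exact hb (orient_self_right _ _)
  have hp0 : bary b c d p = 0 := by
    rcases hp with rfl | rfl
    exacts [bary_left _ _ _, bary_right _ _ _]
  have hq0 : bary b c d q = 0 := by
    rcases hq with rfl | rfl
    exacts [bary_left _ _ _, bary_right _ _ _]
  rw [hp0, hq0] at hcdz
  linarith

lemma IsTriangulation.exists_triangle_toward (hT : IsTriangulation P T) (hgp : GenPos P)
    {b x : Pt} (hb : b ∈ P) (hx : x ∈ convexHull ℝ P) :
    ∃ t ∈ T, b ∈ t ∧ ∃ e : ℝ, 0 < e ∧ (1 - e) • b + e • x ∈ triSet t := by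
  have hev : ∀ᶠ e in nhdsWithin (0 : ℝ) (Set.Ioi 0), ∃ t ∈ T, (1 - e) • b + e • x ∈ triSet t := by
    filter_upwards [self_mem_nhdsWithin, (gt_mem_nhds (zero_lt_one' ℝ)).filter_mono
      nhdsWithin_le_nhds] with e he he1
    have : (1 - e) • b + e • x ∈ ⋃ t ∈ T, triSet t := by
      rw [hT.2.2.2.2]
      exact convex_convexHull ℝ P (subset_convexHull ℝ P hb) hx (by linarith) (le_of_lt he)
        (by ring)
    simpa using this
  obtain ⟨t, ht, hfr⟩ : ∃ t ∈ T, ∃ᶠ e in nhdsWithin (0 : ℝ) (Set.Ioi 0),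
      (1 - e) • b + e • x ∈ triSet t := by
    by_contra! hcon
    have := (Filter.eventually_all_finite hT.1).2 fun t ht => hcon t ht
    obtain ⟨e, ⟨t, ht, h1⟩, h2⟩ := (hev.and this).exists
    exact h2 t ht h1
  have hclosed : IsClosed (triSet t) :=
    (t.finite_toSet.isCompact_convexHull (𝕜 := ℝ)).isClosed
  have htend : Filter.Tendsto (fun e : ℝ => (1 - e) • b + e • x)
      (nhdsWithin (0 : ℝ) (Set.Ioi 0)) (nhds b) := by
    have hc : Continuous fun e : ℝ => (1 - e) • b + e • x := by fun_prop
    have := hc.tendsto 0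
    simp only [sub_zero, one_smul, zero_smul, add_zero] at this
    exact this.mono_left nhdsWithin_le_nhds
  obtain ⟨e, he, he0⟩ := (hfr.and_eventually self_mem_nhdsWithin).exists
  exact ⟨t, ht, hT.mem_of_mem_triSet hgp ht hb (hclosed.mem_of_frequently_of_tendsto hfr htend), e,
    he0, he⟩

/-- A segment along which the orientation with respect to `ab` changes sign meets the line `ab`. -/
lemma exists_comb_orient_eq_zero {a b x y : Pt} (hx : 0 < orient a b x) (hy : orient a b y ≤ 0) :
    ∃ s t : ℝ, 0 ≤ s ∧ 0 < t ∧ s + t = 1 ∧ orient a b (s • x + t • y) = 0 := by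
  refine ⟨-orient a b y / (orient a b x - orient a b y),
    orient a b x / (orient a b x - orient a b y), div_nonneg (by linarith) (by linarith),
    div_pos hx (by linarith), ?_, ?_⟩
  · have : orient a b x - orient a b y ≠ 0 := by linarith
    field_simp
    ring
  · rw [orient_comb]
    · have : orient a b x - orient a b y ≠ 0 := by linarith
      field_simp
      ring
    · have : orient a b x - orient a b y ≠ 0 := by linarith
      field_simp
      ring

lemma exists_comb_of_orient_eq_zero {p q y : Pt} (hpq : p ≠ q) (h : orient p q y = 0) :
    ∃ s t : ℝ, s + t = 1 ∧ y = s • p + t • q := by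
  have hd := (sq_dist_pos hpq).ne'
  refine ⟨1 - ((y 0 - p 0) * (q 0 - p 0) + (y 1 - p 1) * (q 1 - p 1)) /
        ((p 0 - q 0) ^ 2 + (p 1 - q 1) ^ 2), ((y 0 - p 0) * (q 0 - p 0) + (y 1 - p 1) * (q 1 - p 1)) /
        ((p 0 - q 0) ^ 2 + (p 1 - q 1) ^ 2), by ring, ?_⟩
  unfold orient at h
  apply pt_ext <;>
  · simp only [PiLp.add_apply, PiLp.smul_apply, smul_eq_mul]
    field_simp
    first
      | linear_combination (-(q 1 - p 1)) * h
      | linear_combination (q 0 - p 0) * h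

/-- If `pq` is an edge of an order-`k` Delaunay triangulation, then some circle through `p` and `q`
does not contain `v` and has at most `k` points inside on the other side of `pq`. -/
lemma exists_circ_encard_le (hfin : P.Finite) (hgp : GenPos P) {k : ℕ} (hT : IsOrderDT P k T)
    {t₀ : Finset Pt} (ht₀ : t₀ ∈ T) {p q v : Pt} (hp : p ∈ t₀) (hq : q ∈ t₀) (hpq : p ≠ q)
    (hv : v ∈ P) (hov : 0 < orient p q v) :
    ∃ A B C : ℝ, circ A B C p = 0 ∧ circ A B C q = 0 ∧ 0 ≤ circ A B C v ∧
      {w ∈ P | orient p q w < 0 ∧ circ A B C w < 0}.encard ≤ k := by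
  have hpP := (hT.1.2.1 t₀ ht₀).2 hp
  have hqP := (hT.1.2.1 t₀ ht₀).2 hq
  obtain ⟨b, ⟨hb, hob⟩, hmax⟩ := Set.exists_max_image {y ∈ P | 0 < orient p q y}
    (pencilParam p q) (hfin.subset (Set.sep_subset _ _)) ⟨v, hv, hov⟩
  obtain ⟨A, B, C, hfp, hfq, hf⟩ := exists_circ_pencil p q b
  have hfV : ∀ y ∈ P, 0 < orient p q y → 0 ≤ circ A B C y := fun y hy hoy => by
    rw [hf y hoy.ne']
    exact mul_nonneg hoy.le (sub_nonneg.2 (hmax y ⟨hy, hoy⟩))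
  have hfb : circ A B C b = 0 := by rw [hf b hob.ne', sub_self, mul_zero]
  refine ⟨A, B, C, hfp, hfq, hfV v hv hov, ?_⟩
  have hbp : b ≠ p := by rintro rfl; rw [orient_self_left] at hob; exact lt_irrefl _ hob
  have hbq : b ≠ q := by rintro rfl; rw [orient_self_right] at hob; exact lt_irrefl _ hob
  have hhalf : (1 / 2 : ℝ) + 1 / 2 = 1 := by norm_num
  have hfx : circ A B C ((1 / 2 : ℝ) • p + (1 / 2 : ℝ) • q) < 0 := by
    have := circ_comb_two_lt A B C hpq hhalf (by norm_num) (by norm_num)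
    rw [hfp, hfq] at this
    linarith
  have hline : ∀ y, orient p q y = 0 → circ A B C y < 0 →
      ∃ s r : ℝ, 0 < s ∧ 0 < r ∧ s + r = 1 ∧ y = s • p + r • q := by
    intro y hy hfy
    obtain ⟨s, r, hsr, rfl⟩ := exists_comb_of_orient_eq_zero hpq hy
    obtain ⟨h1, h2⟩ := pos_of_circ_neg hfp.ge hfq.ge hhalf (by norm_num) (by norm_num) hfx hsr hfy
    exact ⟨s, r, h1, h2, hsr, rfl⟩
  obtain ⟨s₀, r₀, hs₀, hr₀, hsr₀, hx₀⟩ := hline _ (by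
    rw [orient_comb _ _ _ _ hhalf, orient_self_left, orient_self_right]; ring) hfx
  have hxseg : (1 / 2 : ℝ) • p + (1 / 2 : ℝ) • q ∈ segment ℝ p q :=
    ⟨s₀, r₀, hs₀.le, hr₀.le, hsr₀, hx₀.symm⟩
  have hox : orient p q ((1 / 2 : ℝ) • p + (1 / 2 : ℝ) • q) = 0 := by
    rw [orient_comb _ _ _ _ hhalf, orient_self_left, orient_self_right]; ring
  have hxhull : (1 / 2 : ℝ) • p + (1 / 2 : ℝ) • q ∈ convexHull ℝ P :=
    (convex_convexHull ℝ P).segment_subset (subset_convexHull ℝ P hpP)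
      (subset_convexHull ℝ P hqP) hxseg
  clear hs₀ hr₀ hsr₀ hx₀
  set x := (1 / 2 : ℝ) • p + (1 / 2 : ℝ) • q
  obtain ⟨t, ht, hbt, e, he, hez⟩ := hT.1.exists_triangle_toward hgp hb hxhull
  obtain ⟨c, d, rfl, hc, hd, hbc, hbd, hcd, ho⟩ := hT.1.exists_eq_triple hgp ht hbt
  have ho1 : orient c d b ≠ 0 := by rwa [orient_rotate]
  have ho2 : orient d b c ≠ 0 := by rwa [orient_rotate_right]
  obtain ⟨-, hxc, hxd⟩ := bary_nonneg_all ho hez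
  rw [bary_comb _ _ _ _ _ (by ring), bary_right, mul_zero, zero_add] at hxc
  rw [bary_comb _ _ _ _ _ (by ring), bary_left, mul_zero, zero_add] at hxd
  replace hxc : 0 ≤ bary c d b x := nonneg_of_mul_nonneg_right hxc he
  replace hxd : 0 ≤ bary d b c x := nonneg_of_mul_nonneg_right hxd he
  -- The open edge `pq` does not meet the triangle away from the side `cd`.
  have hnot : ∀ y, orient p q y = 0 → circ A B C y < 0 → 0 < bary b c d y → 0 ≤ bary c d b y →
      0 ≤ bary d b c y → False := by
    intro y hoy hfy h1 h2 h3
    obtain ⟨s, r, hs, hr, hsr, hy⟩ := hline y hoy hfy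
    have hyseg : y ∈ segment ℝ p q := ⟨s, r, hs.le, hr.le, hsr, hy.symm⟩
    have hside : ∀ {a₁ a₂ : Pt}, a₁ ∈ P → a₂ ∈ P → (a₁ = b ∧ a₂ ≠ b ∨ a₁ ≠ b ∧ a₂ = b) →
        ∀ a₃, orient a₃ a₁ a₂ ≠ 0 → bary a₃ a₁ a₂ y = 0 →
          0 < bary a₃ a₁ a₂ p ∨ 0 < bary a₃ a₁ a₂ q := by
      intro a₁ a₂ ha₁ ha₂ hab a₃ hoa hy0
      by_contra! hneg
      rw [hy, bary_comb _ _ _ _ _ hsr] at hy0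
      have hp0 : bary a₃ a₁ a₂ p = 0 := by
        nlinarith [mul_nonneg hs.le (neg_nonneg.2 hneg.1), mul_nonneg hr.le (neg_nonneg.2 hneg.2)]
      have hq0 : bary a₃ a₁ a₂ q = 0 := by
        nlinarith [mul_nonneg hs.le (neg_nonneg.2 hneg.1), mul_nonneg hr.le (neg_nonneg.2 hneg.2)]
      have hne : a₁ ≠ a₂ := by rintro rfl; tauto
      have hmem : ∀ w ∈ P, bary a₃ a₁ a₂ w = 0 → w = a₁ ∨ w = a₂ := by
        intro w hw h0
        by_contra! hcon
        exact div_ne_zero (hgp.orient_ne_zero ha₁ ha₂ hw hne hcon.1.symm hcon.2.symm) hoa h0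
      have hpp := hmem p hpP hp0
      have hqq := hmem q hqP hq0
      rcases hab with ⟨rfl, h⟩ | ⟨h, rfl⟩
      · exact hpq ((hpp.resolve_left hbp.symm).trans (hqq.resolve_left hbq.symm).symm)
      · exact hpq ((hpp.resolve_right hbp.symm).trans (hqq.resolve_right hbq.symm).symm)
    have hpseg := left_mem_segment ℝ p q
    have hqseg := right_mem_segment ℝ p q
    have hyb : y ≠ b := by rintro rfl; rw [hfb] at hfy; exact lt_irrefl _ hfy
    have hfinish : ∀ z ∈ segment ℝ p q, (0 < bary c d b y ∨ 0 < bary c d b z) →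
        (0 < bary d b c y ∨ 0 < bary d b c z) → False := fun z hz h h' =>
      hT.1.not_crossing hgp ht ho ht₀ hp hq hob.ne' hyseg hz h1.le h2 h3 (Or.inl h1) h h'
    rcases h2.lt_or_eq with h2 | h2 <;> rcases h3.lt_or_eq with h3 | h3
    · exact hfinish y hyseg (Or.inl h2) (Or.inl h3)
    · rcases hside hb hc (Or.inl ⟨rfl, hbc.symm⟩) d ho2 h3.symm with h | h
      · exact hfinish p hpseg (Or.inl h2) (Or.inr h)
      · exact hfinish q hqseg (Or.inl h2) (Or.inr h)
    · rcases hside hd hb (Or.inr ⟨hbd.symm, rfl⟩) c ho1 h2.symm with h | h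
      · exact hfinish p hpseg (Or.inr h) (Or.inl h3)
      · exact hfinish q hqseg (Or.inr h) (Or.inl h3)
    · have h4 := bary_sum ho y
      have h5 := bary_smul_add ho y
      rw [← h2, ← h3] at h4 h5
      apply hyb
      rw [← h5, show bary b c d y = 1 by linarith]
      simp
  have hxb : bary b c d x ≤ 0 := by
    by_contra! h
    exact hnot x hox hfx h hxc hxd
  -- The endpoints of the opposite side lie outside the circle.
  have hout : ∀ y ∈ P, (∀ s r : ℝ, 0 ≤ s → 0 < r → s + r = 1 →
      0 ≤ bary c d b (s • b + r • y) ∧ 0 ≤ bary d b c (s • b + r • y)) →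
      bary b c d y = 0 → 0 ≤ circ A B C y := by
    intro y hy hyb hyb0
    by_contra! hfy
    have hoy : orient p q y ≤ 0 := by
      by_contra! h
      exact absurd (hfV y hy h) (not_le.2 hfy)
    rcases hoy.lt_or_eq with hoy' | hoy'
    · obtain ⟨s, r, hs, hr, hsr, hor⟩ := exists_comb_orient_eq_zero hob hoy
      have hs' : 0 < s := by
        rcases hs.lt_or_eq with h | h
        · exact h
        · subst h
          obtain rfl : r = 1 := by linarith
          rw [zero_smul, one_smul, zero_add] at hor
          linarith
      have := circ_comb_two_le A B C b y hsr hs hr.le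
      rw [hfb] at this
      refine hnot _ hor (by nlinarith) ?_ (hyb s r hs hr hsr).1 (hyb s r hs hr hsr).2
      rw [bary_comb _ _ _ _ _ hsr, bary_self ho, hyb0]
      linarith
    · have hyp : y = p ∨ y = q := by
        by_contra! hcon
        exact hgp.orient_ne_zero hpP hqP hy hpq hcon.1.symm hcon.2.symm hoy'
      rcases hyp with rfl | rfl <;> linarith
  have hfc : 0 ≤ circ A B C c := by
    refine hout c hc (fun s r hs hr hsr => ?_) (bary_left _ _ _)
    rw [bary_comb _ _ _ _ _ hsr, bary_comb _ _ _ _ _ hsr, bary_right, bary_self ho1, bary_left,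
      bary_right]
    constructor <;> linarith
  have hfd : 0 ≤ circ A B C d := by
    refine hout d hd (fun s r hs hr hsr => ?_) (bary_right _ _ _)
    rw [bary_comb _ _ _ _ _ hsr, bary_comb _ _ _ _ _ hsr, bary_right, bary_self ho2, bary_left,
      bary_left]
    constructor <;> linarith
  -- The point where the segment from `b` to `x` leaves the triangle.
  obtain ⟨s₁, r₁, hs₁, hr₁, hsr₁, hz₁⟩ : ∃ s r : ℝ, 0 ≤ s ∧ 0 ≤ r ∧ s + r = 1 ∧
      circ A B C (s • c + r • d) < 0 := by
    have hsum := bary_sum ho x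
    have hcomb := bary_smul_add ho x
    have hm : 0 < bary c d b x + bary d b c x := by linarith
    refine ⟨bary c d b x / (bary c d b x + bary d b c x),
      bary d b c x / (bary c d b x + bary d b c x), div_nonneg hxc hm.le, div_nonneg hxd hm.le,
      by field_simp, ?_⟩
    have hz : (bary c d b x / (bary c d b x + bary d b c x)) • c +
        (bary d b c x / (bary c d b x + bary d b c x)) • d =
        (-bary b c d x / (bary c d b x + bary d b c x)) • b +
          (1 / (bary c d b x + bary d b c x)) • x := by
      have hx' : (1 / (bary c d b x + bary d b c x)) • x = (1 / (bary c d b x + bary d b c x)) •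
          (bary b c d x • b + bary c d b x • c + bary d b c x • d) := by rw [hcomb]
      rw [hx']
      module
    rw [hz]
    have h1 := circ_comb_two_le A B C b x
      (a := -bary b c d x / (bary c d b x + bary d b c x))
      (b := 1 / (bary c d b x + bary d b c x)) (by field_simp; linarith)
      (div_nonneg (by linarith) hm.le) (by positivity)
    rw [hfb, mul_zero, zero_add] at h1
    exact h1.trans_lt (mul_neg_of_pos_of_neg (by positivity) hfx)
  have hcdline : ∀ y, bary b c d y = 0 → circ A B C y < 0 →
      0 < bary c d b y ∧ 0 < bary d b c y := by
    intro y hy hfy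
    have hsum := bary_sum ho y
    have hcomb := bary_smul_add ho y
    rw [hy, zero_smul, zero_add] at hcomb
    rw [hy, zero_add] at hsum
    rw [← hcomb] at hfy
    exact pos_of_circ_neg hfc hfd hsr₁ hs₁ hr₁ hz₁ hsum hfy
  obtain ⟨A', B', C', hg, hk⟩ := (hT.2 _ ht).exists_circ ⟨b, by simp⟩
  refine (Set.encard_le_encard ?_).trans hk
  rintro w ⟨hw, how, hfw⟩
  refine ⟨hw, ?_⟩
  rcases le_or_gt (bary b c d w) 0 with hwb | hwb
  · set r := 1 / (1 - bary b c d w) with hr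
    have hr0 : 0 < r := by rw [hr]; apply div_pos <;> linarith
    have hr1 : r ≤ 1 := by rw [hr, div_le_one] <;> linarith
    have hsum : 1 - r + r = 1 := by ring
    have hyb : bary b c d ((1 - r) • b + r • w) = 0 := by
      have : 1 - bary b c d w ≠ 0 := by linarith
      rw [bary_comb _ _ _ _ _ hsum, bary_self ho, hr]
      field_simp
      ring
    have hfy : circ A B C ((1 - r) • b + r • w) < 0 := by
      have := circ_comb_two_le A B C b w hsum (by linarith) hr0.le
      rw [hfb] at this
      nlinarith
    have hl := circ_sub_circ_comb_two A B C A' B' C' b w hsum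
    obtain ⟨hyc, hyd⟩ := hcdline _ hyb hfy
    have h1 := bary_sum ho ((1 - r) • b + r • w)
    have h2 := bary_smul_add ho ((1 - r) • b + r • w)
    set y := (1 - r) • b + r • w
    rw [hyb, zero_smul, zero_add] at h2
    rw [hyb, zero_add] at h1
    have hl' := circ_sub_circ_comb_two A B C A' B' C' c d h1
    rw [h2, hl, hg b (by simp), hg c (by simp), hg d (by simp), hfb] at hl'
    have : 0 ≤ r * (circ A B C w - circ A' B' C' w) := by
      have := mul_nonneg hyc.le hfc
      have := mul_nonneg hyd.le hfd
      linarith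
    have := nonneg_of_mul_nonneg_right this hr0
    linarith
  · exfalso
    obtain ⟨s, r, hs, hr, hsr, hoy⟩ := exists_comb_orient_eq_zero hob how.le
    have hfy : circ A B C (s • b + r • w) < 0 := by
      have := circ_comb_two_le A B C b w hsr hs hr.le
      rw [hfb] at this
      nlinarith
    have hyb : 0 < bary b c d (s • b + r • w) := by
      rw [bary_comb _ _ _ _ _ hsr, bary_self ho]
      nlinarith
    obtain ⟨s', r', hs', hr', hsr', hy'⟩ := hline _ hoy hfy
    have hyseg : s • b + r • w ∈ segment ℝ p q := ⟨s', r', hs'.le, hr'.le, hsr', hy'.symm⟩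
    set y := s • b + r • w
    have hm : 0 < bary b c d y - bary b c d x := by linarith
    have hsum : bary b c d y / (bary b c d y - bary b c d x) +
        -bary b c d x / (bary b c d y - bary b c d x) = 1 := by
      field_simp
      ring
    have hn1 : 0 < bary b c d y / (bary b c d y - bary b c d x) := div_pos hyb hm
    have hn2 : 0 ≤ -bary b c d x / (bary b c d y - bary b c d x) :=
      div_nonneg (by linarith) hm.le
    have hzb : bary b c d ((bary b c d y / (bary b c d y - bary b c d x)) • x +
        (-bary b c d x / (bary b c d y - bary b c d x)) • y) = 0 := by
      rw [bary_comb _ _ _ _ _ hsum]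
      field_simp
      ring
    have hfz := circ_comb_two_le A B C x y hsum hn1.le hn2
    obtain ⟨hzc, hzd⟩ := hcdline _ hzb (by nlinarith)
    refine hT.1.not_crossing hgp ht ho ht₀ hp hq hob.ne'
      ((convex_segment p q) hxseg hyseg hn1.le hn2 hsum) hyseg hzb.ge hzc.le hzd.le
      (Or.inr hyb) (Or.inl hzc) (Or.inl hzd)

lemma exists_wedge_coords {p q u v x w : Pt} {s r s' r' : ℝ} (hsr : s + r = 1)
    (hr : 0 < r) (hx : x = s • p + r • q) (hsr' : s' + r' = 1) (hr' : 0 < r')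
    (hx' : x = s' • u + r' • v) (hup : orient u v p ≠ 0)
    (h1 : 0 < orient u v w / orient u v p) (h2 : 0 < orient p q w / orient p q u) :
    ∃ α β : ℝ, 0 < α ∧ 0 < β ∧ w = (1 - α - β) • x + α • u + β • p := by
  have hpx : ∀ y, orient p x y = r * orient p q y := by
    intro y
    obtain rfl : s = 1 - r := by linarith
    rw [hx]
    simp only [orient, PiLp.add_apply, PiLp.smul_apply, smul_eq_mul]
    ring
  have hxu : ∀ y, orient x u y = -r' * orient u v y := by
    intro y
    obtain rfl : s' = 1 - r' := by linarith
    rw [hx']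
    simp only [orient, PiLp.add_apply, PiLp.smul_apply, smul_eq_mul]
    ring
  have ho : orient x u p ≠ 0 := by
    rw [hxu]
    exact mul_ne_zero (by linarith) hup
  refine ⟨bary u p x w, bary p x u w, ?_, ?_, ?_⟩
  · unfold bary
    rw [← orient_rotate u p x, hpx, hpx, mul_div_mul_left _ _ hr.ne']
    exact h2
  · unfold bary
    rw [← orient_rotate p x u, hxu, hxu, mul_div_mul_left _ _ (by linarith)]
    exact h1
  · have h3 := bary_sum ho w
    rw [show 1 - bary u p x w - bary p x u w = bary x u p w by linarith]
    exact (bary_smul_add ho w).symm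

/-- A disk whose circle passes through `p` and which separates `u` from `v` contains every point of
the disk through `u`, `v`, `p` lying in the wedge at `x` spanned by `u` and `p`. -/
lemma circ_neg_of_mem_wedge {A B C A' B' C' : ℝ} {p u v x w : Pt}
    (hfp : circ A B C p = 0) (hfu : circ A B C u ≤ 0) (hfv : 0 ≤ circ A B C v)
    (hfx : circ A B C x < 0) (hcp : circ A' B' C' p = 0) (hcu : circ A' B' C' u = 0)
    (hcv : circ A' B' C' v = 0) (hcw : circ A' B' C' w < 0) {s r : ℝ} (hs : 0 < s) (hr : 0 < r)
    (hsr : s + r = 1) (hx : x = s • u + r • v) {α β : ℝ} (hα : 0 < α) (hβ : 0 < β)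
    (hw : w = (1 - α - β) • x + α • u + β • p) : circ A B C w < 0 := by
  by_contra! hfw
  have hcx : circ A' B' C' x ≤ 0 := by
    have := circ_comb_two_le A' B' C' u v hsr hs.le hr.le
    rw [← hx, hcu, hcv] at this
    linarith
  have hl1 := circ_sub_circ_comb A B C A' B' C' x u p (a := 1 - α - β) (b := α) (c := β) (by ring)
  rw [← hw, hfp, hcp, hcu] at hl1
  have hαu : α * circ A B C u ≤ 0 := mul_nonpos_of_nonneg_of_nonpos hα.le hfu
  rcases lt_or_ge 0 (1 - α - β) with h | h
  · have := circ_comb_le A B C x u p (a := 1 - α - β) (b := α) (c := β) (by ring) h.le hα.le hβ.le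
    rw [← hw, hfp] at this
    have := mul_neg_of_pos_of_neg h hfx
    linarith
  · have hneg : circ A B C x - circ A' B' C' x < 0 := by
      by_contra! h'
      have := mul_nonpos_of_nonpos_of_nonneg h h'
      linarith
    have hpc : p = (1 / β) • w + (α * r / s / β) • v + ((β - 1 - α * r / s) / β) • x := by
      rw [hw, hx]
      obtain rfl : r = 1 - s := by linarith
      apply pt_ext <;>
      · simp only [PiLp.add_apply, PiLp.smul_apply, smul_eq_mul]
        field_simp
        ring
    have hsum : 1 / β + α * r / s / β + (β - 1 - α * r / s) / β = 1 := by
      field_simp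
      ring
    have hk : 0 < α * r / s := by positivity
    have hl2 := circ_sub_circ_comb A B C A' B' C' w v x hsum
    rw [← hpc, hfp, hcp, hcv] at hl2
    have h1 : 0 < 1 / β := by positivity
    have h2 : 0 < α * r / s / β := by positivity
    have h3 : 0 ≤ (β - 1 - α * r / s) / β := by
      by_contra! h3
      have t1 := mul_pos_of_neg_of_neg h3 hneg
      have t2 := mul_nonneg h2.le hfv
      have t3 : 0 < 1 / β * (circ A B C w - circ A' B' C' w) := mul_pos h1 (by linarith)
      linarith
    have := circ_comb_le A' B' C' w v x hsum h1.le h2.le h3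
    rw [← hpc, hcp, hcv] at this
    have t1 := mul_nonpos_of_nonneg_of_nonpos h3 hcx
    have t2 := mul_neg_of_pos_of_neg h1 hcw
    linarith

/-- The endpoints to the left of `uv` of the useful order-`k` Delaunay edges crossing `uv`. -/
def leftEndpoints (P : Set Pt) (k : ℕ) (u v : Pt) : Set Pt :=
  {p ∈ P | 0 < orient u v p ∧ ∃ q ∈ P, orient u v q < 0 ∧ UsefulEdge P k p q ∧
    (openSegment ℝ p q ∩ openSegment ℝ u v).Nonempty}

/-- A circle through two points separated by a Delaunay edge contains one of the endpoints of
that edge if it does not contain the other one. -/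
lemma circ_neg_of_crossing {A B C A' B' C' : ℝ} {p q u v x : Pt} (hfp : circ A B C p = 0)
    (hfq : circ A B C q = 0) (hfv : 0 ≤ circ A B C v) (heu : circ A' B' C' u = 0)
    (hev : circ A' B' C' v = 0) (hep : 0 ≤ circ A' B' C' p) (heq : 0 ≤ circ A' B' C' q)
    (hne : circ A' B' C' p ≠ 0 ∨ circ A' B' C' q ≠ 0) {s r s' r' : ℝ} (hs : 0 < s) (hr : 0 < r)
    (hsr : s + r = 1) (hx : x = s • p + r • q) (hs' : 0 < s') (hr' : 0 < r')
    (hsr' : s' + r' = 1) (hx' : x = s' • u + r' • v) : circ A B C u < 0 := by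
  have h1 := circ_sub_circ_comb_two A B C A' B' C' p q hsr
  have h2 := circ_sub_circ_comb_two A B C A' B' C' u v hsr'
  rw [← hx, hfp, hfq] at h1
  rw [← hx', h1, heu, hev] at h2
  have h3 : 0 < s * circ A' B' C' p + r * circ A' B' C' q := by
    rcases hne with h | h
    · have := mul_pos hs (hep.lt_of_ne' h)
      have := mul_nonneg hr.le heq
      linarith
    · have := mul_pos hr (heq.lt_of_ne' h)
      have := mul_nonneg hs.le hep
      linarith
  have h4 := mul_nonneg hr'.le hfv
  by_contra! h5
  have h6 := mul_nonneg hs'.le h5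
  linarith

lemma ncard_leftEndpoints_le (hfin : P.Finite) (hgp : GenPos P) (k : ℕ) {u v : Pt} (hu : u ∈ P)
    (hv : v ∈ P) (huv : u ≠ v) (hdel : DelaunayEdge P u v) :
    (leftEndpoints P k u v).ncard ≤ 2 * k := by
  rcases (leftEndpoints P k u v).eq_empty_or_nonempty with h0 | hnonempty
  · simp [h0]
  obtain ⟨p, hpL, hmin⟩ : ∃ p ∈ leftEndpoints P k u v, ∀ w ∈ leftEndpoints P k u v,
      pencilParam u v p ≤ pencilParam u v w :=
    Set.exists_min_image _ _ (hfin.subset (Set.sep_subset _ _)) hnonempty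
  obtain ⟨hp, hup, q, hq, huq, ⟨T, hT, t₀, ht₀, hpt, hqt⟩, x, ⟨s, r, hs, hr, hsr, hx⟩,
    s', r', hs', hr', hsr', hx'⟩ := id hpL
  have hpq : p ≠ q := by rintro rfl; exact lt_asymm hup huq
  have hpu : p ≠ u := by rintro rfl; rw [orient_self_left] at hup; exact lt_irrefl _ hup
  have hpv : p ≠ v := by rintro rfl; rw [orient_self_right] at hup; exact lt_irrefl _ hup
  have hqu : q ≠ u := by rintro rfl; rw [orient_self_left] at huq; exact lt_irrefl _ huq
  have hqv : q ≠ v := by rintro rfl; rw [orient_self_right] at huq; exact lt_irrefl _ huq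
  have hpx : ∀ y, orient p x y = r * orient p q y := by
    intro y
    obtain rfl : s = 1 - r := by linarith
    rw [← hx]
    simp only [orient, PiLp.add_apply, PiLp.smul_apply, smul_eq_mul]
    ring
  have hpqu : orient p q u < 0 := by
    have h1 : orient p x u = -r' * orient u v p := by
      obtain rfl : s' = 1 - r' := by linarith
      rw [← hx']
      simp only [orient, PiLp.add_apply, PiLp.smul_apply, smul_eq_mul]
      ring
    rw [hpx] at h1
    by_contra! h
    nlinarith [mul_nonneg hr.le h, mul_pos hr' hup]
  have hpqv : 0 < orient p q v := by
    have h1 : orient p x v = s' * orient u v p := by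
      obtain rfl : s' = 1 - r' := by linarith
      rw [← hx']
      simp only [orient, PiLp.add_apply, PiLp.smul_apply, smul_eq_mul]
      ring
    rw [hpx] at h1
    by_contra! h
    nlinarith [mul_nonneg hr.le (neg_nonneg.2 h), mul_pos hs' hup]
  obtain ⟨A₁, B₁, C₁, h1p, h1q, h1v, hk₁⟩ :=
    exists_circ_encard_le hfin hgp hT ht₀ hpt hqt hpq hv hpqv
  obtain ⟨A₂, B₂, C₂, h2q, h2p, h2u, hk₂⟩ :=
    exists_circ_encard_le hfin hgp hT ht₀ hqt hpt hpq.symm hu (by rw [orient_swap]; linarith)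
  obtain ⟨A, B, C, heu, hev, he⟩ := hdel.exists_circ
  have hne : circ A B C p ≠ 0 ∨ circ A B C q ≠ 0 := by
    by_contra! h
    exact hgp.circ_ne_zero hu hv hp hq huv hpu.symm hqu.symm hpv.symm hqv.symm hpq heu hev h.1 h.2
  have h1u : circ A₁ B₁ C₁ u < 0 := circ_neg_of_crossing h1p h1q h1v heu hev (he p hp) (he q hq)
    hne hs hr hsr hx.symm hs' hr' hsr' hx'.symm
  have h2v : circ A₂ B₂ C₂ v < 0 := circ_neg_of_crossing h2p h2q h2u hev heu (he p hp) (he q hq)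
    hne hs hr hsr hx.symm hr' hs' (by rwa [add_comm]) (by rw [add_comm]; exact hx'.symm)
  have h1x : circ A₁ B₁ C₁ x < 0 := by
    have := circ_comb_two_lt A₁ B₁ C₁ hpq hsr hs hr
    rw [hx, h1p, h1q] at this
    linarith
  have h2x : circ A₂ B₂ C₂ x < 0 := by
    have := circ_comb_two_lt A₂ B₂ C₂ hpq hsr hs hr
    rw [hx, h2p, h2q] at this
    linarith
  obtain ⟨A', B', C', hcu, hcv, hc⟩ := exists_circ_pencil u v p
  have hcp : circ A' B' C' p = 0 := by rw [hc p hup.ne', sub_self, mul_zero]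
  have hsub : insert u (leftEndpoints P k u v \ {p}) ⊆
      {w ∈ P | orient p q w < 0 ∧ circ A₁ B₁ C₁ w < 0} ∪
        {w ∈ P | orient q p w < 0 ∧ circ A₂ B₂ C₂ w < 0} := by
    rintro w (rfl | ⟨hwL, hwp⟩)
    · exact Or.inl ⟨hu, hpqu, h1u⟩
    · obtain ⟨hw, huw, -⟩ := id hwL
      have hwp : w ≠ p := hwp
      have hwu : w ≠ u := by rintro rfl; rw [orient_self_left] at huw; exact lt_irrefl _ huw
      have hwv : w ≠ v := by rintro rfl; rw [orient_self_right] at huw; exact lt_irrefl _ huw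
      have hwq : w ≠ q := by rintro rfl; exact lt_asymm huw huq
      have hcw : circ A' B' C' w < 0 := by
        refine lt_of_le_of_ne ?_ (hgp.circ_ne_zero hu hv hp hw huv hpu.symm hwu.symm hpv.symm
          hwv.symm hwp.symm hcu hcv hcp)
        rw [hc w huw.ne']
        exact mul_nonpos_of_nonneg_of_nonpos huw.le (sub_nonpos.2 (hmin w hwL))
      rcases (hgp.orient_ne_zero hp hq hw hpq hwp.symm hwq.symm).lt_or_gt with ho | ho
      · left
        obtain ⟨α, β, hα, hβ, hwe⟩ := exists_wedge_coords (w := w) hsr hr hx.symm hsr' hr' hx'.symm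
          hup.ne' (div_pos huw hup) (div_pos_of_neg_of_neg ho hpqu)
        exact ⟨hw, ho, circ_neg_of_mem_wedge h1p h1u.le h1v h1x hcp hcu hcv hcw hs' hr' hsr'
          hx'.symm hα hβ hwe⟩
      · right
        rw [add_comm] at hx' hsr'
        obtain ⟨α, β, hα, hβ, hwe⟩ := exists_wedge_coords (w := w) hsr hr hx.symm hsr' hs' hx'.symm
          (by rw [orient_swap]; linarith)
          (by rw [orient_swap, orient_swap u v p, neg_div_neg_eq]; exact div_pos huw hup)
          (div_pos ho hpqv)
        exact ⟨hw, by rw [orient_swap]; linarith, circ_neg_of_mem_wedge h2p h2v.le h2u h2x hcp hcv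
          hcu hcw hr' hs' hsr' hx'.symm hα hβ hwe⟩
  have huL : u ∉ leftEndpoints P k u v \ {p} := by
    rintro ⟨⟨-, h, -⟩, -⟩
    rw [orient_self_left] at h
    exact lt_irrefl _ h
  have hcard : (leftEndpoints P k u v).encard ≤ ((2 * k : ℕ) : ℕ∞) := by
    rw [← Set.encard_sdiff_singleton_add_one hpL, ← Set.encard_insert_of_notMem huL]
    refine (Set.encard_le_encard hsub).trans ((Set.encard_union_le _ _).trans ?_)
    rw [two_mul, Nat.cast_add]
    exact add_le_add hk₁ hk₂
  exact ENat.toNat_le_of_le_natCast hcard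

lemma UsefulEdge.symm {k : ℕ} {p q : Pt} (h : UsefulEdge P k p q) : UsefulEdge P k q p := by
  obtain ⟨T, hT, t, ht, h1, h2⟩ := h
  exact ⟨T, hT, t, ht, h2, h1⟩

lemma eq_pair_or_opposite_of_crossing (hgp : GenPos P) {u v p q : Pt} (hu : u ∈ P) (hv : v ∈ P)
    (hp : p ∈ P) (hq : q ∈ P) (huv : u ≠ v) (hpq : p ≠ q)
    (h : (openSegment ℝ p q ∩ openSegment ℝ u v).Nonempty) :
    ({p, q} : Finset Pt) = {u, v} ∨ (0 < orient u v p ∧ orient u v q < 0) ∨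
      (orient u v p < 0 ∧ 0 < orient u v q) := by
  obtain ⟨x, ⟨s, r, hs, hr, hsr, hx⟩, s', r', hs', hr', hsr', hx'⟩ := h
  have h1 : s * orient u v p + r * orient u v q = 0 := by
    rw [← orient_comb _ _ _ _ hsr, hx, ← hx', orient_comb _ _ _ _ hsr', orient_self_left,
      orient_self_right]
    ring
  rcases lt_trichotomy (orient u v p) 0 with h2 | h2 | h2
  · refine Or.inr (Or.inr ⟨h2, ?_⟩)
    by_contra! h3
    nlinarith [mul_pos hs (neg_pos.2 h2), mul_nonneg hr.le (neg_nonneg.2 h3)]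
  · left
    have h3 : orient u v q = 0 := by
      rw [h2, mul_zero, zero_add] at h1
      exact (mul_eq_zero.1 h1).resolve_left hr.ne'
    have hmem : ∀ w ∈ P, orient u v w = 0 → w = u ∨ w = v := by
      intro w hw hw0
      by_contra! hcon
      exact hgp.orient_ne_zero hu hv hw huv hcon.1.symm hcon.2.symm hw0
    rcases hmem p hp h2 with rfl | rfl <;> rcases hmem q hq h3 with rfl | rfl
    · exact absurd rfl hpq
    · rfl
    · exact Finset.pair_comm _ _
    · exact absurd rfl hpq
  · refine Or.inr (Or.inl ⟨h2, ?_⟩)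
    by_contra! h3
    nlinarith [mul_pos hs h2, mul_nonneg hr.le h3]

end Triangulation

/-- Lemma 2.12: if `{u,v}` is a side of some triangle of the Delaunay triangulation of
`P` and `k ≥ 1`, then the number of pairs of points of `P` that are useful order-`k`
Delaunay edges and whose open segment intersects the open segment `uv` is at most
`(2k + 1)²`. -/
theorem card_useful_edges_crossing_delaunay_edge
    (P : Set Pt) (hfin : P.Finite) (hgp : GenPos P) (k : ℕ) (hk : 1 ≤ k)
    (u v : Pt) (hu : u ∈ P) (hv : v ∈ P) (huv : u ≠ v)
    (hdel : DelaunayEdge P u v) :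
    {e : Finset Pt | ∃ p q : Pt, p ∈ P ∧ q ∈ P ∧ p ≠ q ∧ e = {p, q} ∧
        UsefulEdge P k p q ∧
        (openSegment ℝ p q ∩ openSegment ℝ u v).Nonempty}.ncard
      ≤ (2 * k + 1) ^ 2 := by
  set L := leftEndpoints P k u v
  set R := leftEndpoints P k v u
  have hL : L.ncard ≤ 2 * k := ncard_leftEndpoints_le hfin hgp k hu hv huv hdel
  have hR : R.ncard ≤ 2 * k := ncard_leftEndpoints_le hfin hgp k hv hu huv.symm (UsefulEdge.symm hdel)
  have hLf : L.Finite := hfin.subset (Set.sep_subset _ _)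
  have hRf : R.Finite := hfin.subset (Set.sep_subset _ _)
  have hfinite := ((hLf.prod hRf).image fun z : Pt × Pt => ({z.1, z.2} : Finset Pt)).insert {u, v}
  refine (Set.ncard_le_ncard ?_ hfinite).trans ?_
  · rintro _ ⟨p, q, hp, hq, hpq, rfl, huse, hx⟩
    have hswap : (openSegment ℝ q p ∩ openSegment ℝ v u).Nonempty := by
      rwa [openSegment_symm ℝ q p, openSegment_symm ℝ v u]
    rcases eq_pair_or_opposite_of_crossing hgp hu hv hp hq huv hpq hx with h | h | h
    · exact Or.inl h
    · refine Or.inr ⟨(p, q), ⟨⟨hp, h.1, q, hq, h.2, huse, hx⟩, hq, ?_, p, hp, ?_, huse.symm, hswap⟩,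
        rfl⟩ <;>
      · rw [orient_swap]
        linarith
    · refine Or.inr ⟨(q, p), ⟨⟨hq, h.2, p, hp, h.1, huse.symm, ?_⟩, hp, ?_, q, hq, ?_, huse, ?_⟩,
        Finset.pair_comm _ _⟩
      · rwa [openSegment_symm ℝ q p]
      · rw [orient_swap]
        linarith
      · rw [orient_swap]
        linarith
      · rwa [openSegment_symm ℝ v u]
  · refine (Set.ncard_insert_le _ _).trans ?_
    have h1 := Set.ncard_image_le (f := fun z : Pt × Pt => ({z.1, z.2} : Finset Pt))
      (hLf.prod hRf)
    rw [Set.ncard_prod] at h1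
    have h2 := Nat.mul_le_mul hL hR
    nlinarith

end
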